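/- Let x ∈ ℓ₁ with ‖x‖ ≤ 1, φ ∈ ℓ∞ with ‖φ‖ ≤ 1, and 0 < ε < 1 be such that Re(∑ⱼ φⱼ xⱼ) ≥ 1 − ε³/60. Then there exists a pair (x₀, φ₀) with ‖x₀‖ = ‖φ₀‖ = 1 and ∑ⱼ (φ₀)ⱼ (x₀)ⱼ = 1 such that ‖x − x₀‖ ≤ ε, ‖φ − φ₀‖ ≤ ε, and moreover φ₀ can be taken to be (φ₀)ⱼ = e^{i·arg(φⱼ)} if |φⱼ| ≥ 1 − ε²/20 and (φ₀)ⱼ = φⱼ otherwise. -/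

import Mathlib

open scoped ENNReal

/-- A complex number is close to its modulus when its real part is. -/
lemma Complex.norm_sub_ofReal_norm_le (z : ℂ) {c : ℝ} (hc : 0 < c) :
    ‖z - (‖z‖ : ℂ)‖ ≤ c / 2 * ‖z‖ + (‖z‖ - z.re) / c := by
  have hre : z.re ≤ ‖z‖ := Complex.re_le_norm z
  have hsq : ‖z - (‖z‖ : ℂ)‖ ^ 2 = 2 * ‖z‖ * (‖z‖ - z.re) := by
    have h : ‖z‖ ^ 2 = z.re ^ 2 + z.im ^ 2 := by
      rw [Complex.sq_norm, Complex.normSq_apply]; ring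
    rw [Complex.sq_norm, Complex.normSq_apply]
    simp only [Complex.sub_re, Complex.sub_im, Complex.ofReal_re, Complex.ofReal_im]
    linear_combination -h
  have hnonneg : 0 ≤ c / 2 * ‖z‖ + (‖z‖ - z.re) / c :=
    add_nonneg (by positivity) (div_nonneg (by linarith) hc.le)
  refine le_of_sq_le_sq ?_ hnonneg
  have hprod : c / 2 * ‖z‖ * ((‖z‖ - z.re) / c) * 4 = 2 * ‖z‖ * (‖z‖ - z.re) := by
    field_simp
    ring
  nlinarith [sq_nonneg (c / 2 * ‖z‖ - (‖z‖ - z.re) / c)]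

lemma lp.hasSum_norm_one (x : lp (fun _ : ℕ => ℂ) 1) : HasSum (fun j => ‖x j‖) ‖x‖ := by
  simpa using lp.hasSum_norm (p := 1) (by simp) x

/-- If `z` has modulus in `[1 - d, 1]` and `Re (z * w)` is close to `‖w‖`, then `w` is close to
`‖w‖` rotated against the phase of `z`. -/
lemma Complex.norm_sub_inv_exp_arg_mul_norm_le {z w : ℂ} {d c : ℝ} (hd : d < 1) (hc : 0 < c)
    (hz : 1 - d ≤ ‖z‖) (hz1 : ‖z‖ ≤ 1) :
    ‖w - (Complex.exp (Complex.arg z * Complex.I))⁻¹ * (‖w‖ : ℂ)‖ ≤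
      c / 2 * ‖w‖ + (‖w‖ - (z * w).re) / ((1 - d) * c) := by
  set u := Complex.exp (Complex.arg z * Complex.I)
  have hu1 : ‖u‖ = 1 := Complex.norm_exp_ofReal_mul_I _
  have hu0 : u ≠ 0 := Complex.exp_ne_zero _
  have hzu : (‖z‖ : ℂ) * u = z := Complex.norm_mul_exp_arg_mul_I z
  have hn : ‖u * w‖ = ‖w‖ := by rw [norm_mul, hu1, one_mul]
  have hle := Complex.norm_sub_ofReal_norm_le (u * w) hc
  have hleft : ‖u * w - (‖u * w‖ : ℂ)‖ = ‖w - u⁻¹ * (‖w‖ : ℂ)‖ := by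
    have : u * w - (‖w‖ : ℂ) = u * (w - u⁻¹ * (‖w‖ : ℂ)) := by field_simp
    rw [hn, this, norm_mul, hu1, one_mul]
  have hre : (z * w).re = ‖z‖ * (u * w).re := by
    rw [← Complex.re_ofReal_mul, ← mul_assoc, hzu]
  rw [hleft, hn] at hle
  refine hle.trans (add_le_add le_rfl ?_)
  have hwre : (u * w).re ≤ ‖w‖ := hn ▸ Complex.re_le_norm _
  have hd' : 0 < 1 - d := by linarith
  rw [hre, ← div_div]
  refine div_le_div_of_nonneg_right ?_ hc.le
  rw [le_div_iff₀ hd']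
  nlinarith [mul_nonneg (sub_nonneg.2 hwre) (sub_nonneg.2 hz),
    mul_nonneg (norm_nonneg w) (sub_nonneg.2 hz1)]

/-- Second constructive Bishop–Phelps–Bollobás theorem in `ℓ₁(ℂ)`: if `‖x‖ ≤ 1`,
`‖φ‖ ≤ 1` and `Re(∑ⱼ φⱼ xⱼ) ≥ 1 - ε³/60`, then there is a pair `(x₀, φ₀)` with
`‖x₀‖ = ‖φ₀‖ = 1`, `∑ⱼ (φ₀)ⱼ (x₀)ⱼ = 1`, `‖x - x₀‖ ≤ ε`, `‖φ - φ₀‖ ≤ ε`, where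
`(φ₀)ⱼ = e^{i·arg(φⱼ)}` if `|φⱼ| ≥ 1 - ε²/20` and `(φ₀)ⱼ = φⱼ` otherwise. -/
theorem bpb_l1_second_constructive
    (x : lp (fun _ : ℕ => ℂ) 1) (φ : lp (fun _ : ℕ => ℂ) ∞)
    (hx : ‖x‖ ≤ 1) (hφ : ‖φ‖ ≤ 1) (ε : ℝ) (hε0 : 0 < ε) (hε1 : ε < 1)
    (hpair : 1 - ε ^ 3 / 60 ≤ (∑' j : ℕ, φ j * x j).re) :
    ∃ (x₀ : lp (fun _ : ℕ => ℂ) 1) (φ₀ : lp (fun _ : ℕ => ℂ) ∞),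
      (∀ j : ℕ, 1 - ε ^ 2 / 20 ≤ ‖φ j‖ →
        φ₀ j = Complex.exp (Complex.arg (φ j) * Complex.I)) ∧
      (∀ j : ℕ, ‖φ j‖ < 1 - ε ^ 2 / 20 → φ₀ j = φ j) ∧
      ‖x₀‖ = 1 ∧ ‖φ₀‖ = 1 ∧ (∑' j : ℕ, φ₀ j * x₀ j) = 1 ∧
      ‖x - x₀‖ ≤ ε ∧ ‖φ - φ₀‖ ≤ ε := by
  set d : ℝ := ε ^ 2 / 20 with hd
  have hd0 : 0 < d := by positivity
  have hd20 : d < 1 / 20 := by rw [hd]; nlinarith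
  have hφ1 (j : ℕ) : ‖φ j‖ ≤ 1 := (lp.norm_apply_le_norm (by simp) φ j).trans hφ
  have hsumx := lp.hasSum_norm_one x
  have hsre (j : ℕ) : (φ j * x j).re ≤ ‖φ j‖ * ‖x j‖ :=
    (Complex.re_le_norm _).trans_eq (norm_mul _ _)
  have hsummable : Summable fun j => φ j * x j :=
    Summable.of_norm_bounded hsumx.summable fun j => by
      rw [norm_mul]
      exact mul_le_of_le_one_left (norm_nonneg _) (hφ1 j)
  have hsumre := Complex.hasSum_re hsummable.hasSum
  set R := (∑' j : ℕ, φ j * x j).re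
  set b : ℕ → ℝ := fun j => if 1 - d ≤ ‖φ j‖ then ‖x j‖ else 0 with hb
  have hb0 (j : ℕ) : 0 ≤ b j := by simp only [hb]; split_ifs <;> simp
  have hbx (j : ℕ) : b j ≤ ‖x j‖ := by simp only [hb]; split_ifs <;> simp
  obtain ⟨A, hA⟩ := Summable.of_nonneg_of_le hb0 hbx hsumx.summable
  have hmass : d * (‖x‖ - A) ≤ ‖x‖ - R := by
    refine hasSum_le (fun j => ?_) ((hsumx.sub hA).mul_left d) (hsumx.sub hsumre)
    have h1 := hsre j
    have h2 := norm_nonneg (x j)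
    simp only [hb]
    split_ifs with h
    · nlinarith [hφ1 j]
    · nlinarith
  have hAx : A ≤ ‖x‖ := hasSum_le hbx hA hsumx
  have htail : ‖x‖ - A ≤ ε / 3 := by
    have : d * (‖x‖ - A) ≤ d * (ε / 3) := by rw [hd] at hmass ⊢; nlinarith
    exact le_of_mul_le_mul_left this hd0
  have hε3 : ε ^ 3 ≤ ε := by nlinarith [mul_pos hε0 hε0]
  have hRx : R ≤ ‖x‖ := by nlinarith
  have hA0 : 0 < A := by linarith
  set u : ℕ → ℂ := fun j => Complex.exp (Complex.arg (φ j) * Complex.I)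
  have hu1 (j : ℕ) : ‖u j‖ = 1 := Complex.norm_exp_ofReal_mul_I _
  have hu0 (j : ℕ) : u j ≠ 0 := Complex.exp_ne_zero _
  set f : ℕ → ℂ := fun j => (u j)⁻¹ * (b j / A : ℝ) with hf
  have hfnorm (j : ℕ) : ‖f j‖ = b j / A := by
    rw [hf, norm_mul, norm_inv, hu1, inv_one, one_mul, Complex.norm_real, Real.norm_eq_abs,
      abs_of_nonneg (div_nonneg (hb0 j) hA0.le)]
  have hsumf : HasSum (fun j => b j / A) 1 := by
    simpa [hA0.ne'] using hA.div_const A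
  have hfmem : Memℓp f 1 := memℓp_gen (by simpa [hfnorm] using hsumf.summable)
  set g : ℕ → ℂ := fun j => if 1 - d ≤ ‖φ j‖ then u j else φ j with hg
  have hg1 (j : ℕ) : ‖g j‖ ≤ 1 := by
    simp only [hg]
    split_ifs
    exacts [(hu1 j).le, hφ1 j]
  have hgmem : Memℓp g ∞ := memℓp_infty ⟨1, by rintro _ ⟨j, rfl⟩; exact hg1 j⟩
  obtain ⟨k, hk⟩ : ∃ k, 1 - d ≤ ‖φ k‖ := by
    by_contra! h
    have : b = fun _ => 0 := funext fun j => if_neg (h j).not_ge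
    rw [this] at hA
    exact hA0.ne' (hA.unique hasSum_zero)
  have hclose (j : ℕ) : ‖x j - f j‖ ≤ (‖x j‖ - b j) +
      (ε / 5 / 2 * ‖x j‖ + (‖x j‖ - (φ j * x j).re) / ((1 - d) * (ε / 5))) +
      (b j / A - b j) := by
    by_cases h : 1 - d ≤ ‖φ j‖
    · have hbj : b j = ‖x j‖ := if_pos h
      have h1 := Complex.norm_sub_inv_exp_arg_mul_norm_le (w := x j) (c := ε / 5)
        (by linarith : d < 1) (by positivity) h (hφ1 j)
      have hle : b j ≤ b j / A := by
        rw [le_div_iff₀ hA0]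
        exact mul_le_of_le_one_right (hb0 j) (hAx.trans hx)
      have h2 : ‖(u j)⁻¹ * (‖x j‖ : ℂ) - f j‖ = b j / A - b j := by
        rw [hf, ← hbj, ← mul_sub, norm_mul, norm_inv, hu1, inv_one, one_mul,
          ← Complex.ofReal_sub, Complex.norm_real, Real.norm_eq_abs, abs_sub_comm,
          abs_of_nonneg (sub_nonneg.2 hle)]
      have h3 := norm_sub_le_norm_sub_add_norm_sub (x j) ((u j)⁻¹ * (‖x j‖ : ℂ)) (f j)
      rw [h2] at h3
      linarith
    · have hbj : b j = 0 := if_neg h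
      have hfj : f j = 0 := by simp [hf, hbj]
      have : 0 ≤ (‖x j‖ - (φ j * x j).re) / ((1 - d) * (ε / 5)) := by
        refine div_nonneg ?_ (mul_nonneg (by linarith) (by positivity))
        nlinarith [hsre j, hφ1 j, norm_nonneg (x j)]
      have : 0 ≤ ε / 5 / 2 * ‖x j‖ := by positivity
      rw [hbj, hfj]
      simp only [sub_zero, zero_div]
      linarith
  refine ⟨⟨f, hfmem⟩, ⟨g, hgmem⟩, fun j h => if_pos h, fun j h => if_neg h.not_ge, ?_, ?_, ?_,
    ?_, ?_⟩
  · refine (lp.hasSum_norm_one _).unique ?_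
    simpa [hfnorm] using hsumf
  · refine le_antisymm (lp.norm_le_of_forall_le zero_le_one hg1) ?_
    have := lp.norm_apply_le_norm (by simp) (⟨g, hgmem⟩ : lp (fun _ : ℕ => ℂ) ∞) k
    have hgk : g k = u k := if_pos hk
    simpa [hgk, hu1] using this
  · have hgf (j : ℕ) : g j * f j = ((b j / A : ℝ) : ℂ) := by
      by_cases h : 1 - d ≤ ‖φ j‖
      · have hgj : g j = u j := if_pos h
        rw [hgj, hf, mul_inv_cancel_left₀ (hu0 j)]
      · have hbj : b j = 0 := if_neg h
        simp [hf, hbj]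
    refine HasSum.tsum_eq ?_
    simp only [hgf]
    simpa only [Complex.ofReal_one] using Complex.hasSum_ofReal.2 hsumf
  · have hbound := ((hsumx.sub hA).add ((hsumx.mul_left (ε / 5 / 2)).add
      ((hsumx.sub hsumre).div_const ((1 - d) * (ε / 5))))).add (hsumf.sub hA)
    have hnorm := lp.hasSum_norm_one (x - (⟨f, hfmem⟩ : lp (fun _ : ℕ => ℂ) 1))
    refine (hasSum_le hclose hnorm hbound).trans ?_
    have h1 : (‖x‖ - R) / ((1 - d) * (ε / 5)) ≤ ε / 10 := by
      have hden : 0 < (1 - d) * (ε / 5) := mul_pos (by linarith) (by positivity)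
      rw [div_le_iff₀ hden]
      nlinarith [mul_pos hε0 hε0]
    nlinarith
  · refine lp.norm_le_of_forall_le hε0.le fun j => ?_
    change ‖φ j - g j‖ ≤ ε
    by_cases h : 1 - d ≤ ‖φ j‖
    · have hgj : g j = u j := if_pos h
      have hφu : φ j - u j = ((‖φ j‖ - 1 : ℝ) : ℂ) * u j := by
        have := Complex.norm_mul_exp_arg_mul_I (φ j)
        push_cast
        rw [sub_mul, this, one_mul]
      rw [hgj, hφu, norm_mul, hu1, mul_one, Complex.norm_real, Real.norm_eq_abs, abs_sub_comm,
        abs_of_nonneg (sub_nonneg.2 (hφ1 j))]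
      nlinarith
    · have hgj : g j = φ j := if_neg h
      simp [hgj, hε0.le]
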